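/- arXiv:2309.05673 — 2 statements merged into one kernel-verified Lean document; each statement's English description precedes it below -/
import Mathlib

section
/- Suppose ν ≥ 1. Then ∑_{σ ∈ J_{μ,ν}(1,…,r)} ∑_{i=1}^{ν} (−1)^{μ+i−1}·(−1)^{σ}·Φ(σ(1), …, σ(μ+i)̂, …, σ(r))·Ψ(σ(μ+i)) = ∑_{j=1}^{r} (−1)^{j−1}·Ψ(j)·∑_{τ ∈ J_{μ,ν−1}(1,…,ĵ,…,r)} (−1)^{τ}·Φ(τ(1), …, τ(r−1)), where σ(μ+i)̂ means the (μ+i)-th entry is omitted from the tuple (σ(1),…,σ(r)). -/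
open Finset

/-- `σ` is a 3-shuffle with block sizes `μ`, `ν`, `r − μ − ν`: it is strictly
increasing on the first `μ` positions, on the next `ν` positions, and on the
remaining positions. -/
def IsShuffle3 {r : ℕ} (μ ν : ℕ) (σ : Equiv.Perm (Fin r)) : Prop :=
  (∀ i j : Fin r, i < j → j.val < μ → σ i < σ j) ∧
  (∀ i j : Fin r, i < j → μ ≤ i.val → j.val < μ + ν → σ i < σ j) ∧
  (∀ i j : Fin r, i < j → μ + ν ≤ i.val → σ i < σ j)

/-- Extend `τ` to a permutation sending `i` to `j`. -/
def extPerm {n : ℕ} (i j : Fin (n + 1)) (τ : Equiv.Perm (Fin n)) : Equiv.Perm (Fin (n + 1)) :=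
  (i.cycleRange.trans (Equiv.Perm.decomposeFin.symm (0, τ))).trans j.cycleRange.symm

theorem extPerm_self {n : ℕ} (i j : Fin (n + 1)) (τ : Equiv.Perm (Fin n)) :
    extPerm i j τ i = j := by
  simp [extPerm]

theorem extPerm_succAbove {n : ℕ} (i j : Fin (n + 1)) (τ : Equiv.Perm (Fin n)) (t : Fin n) :
    extPerm i j τ (i.succAbove t) = j.succAbove (τ t) := by
  simp [extPerm]

theorem sign_extPerm {n : ℕ} (i j : Fin (n + 1)) (τ : Equiv.Perm (Fin n)) :
    Equiv.Perm.sign (extPerm i j τ) = (-1) ^ (i.val + j.val) * Equiv.Perm.sign τ := by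
  simp [extPerm, Equiv.Perm.sign_trans, pow_add]
  simp only [mul_comm, mul_left_comm, mul_assoc]

theorem extPerm_bijective {n : ℕ} (i : Fin (n + 1)) :
    Function.Bijective (fun p : Fin (n + 1) × Equiv.Perm (Fin n) => extPerm i p.1 p.2) := by
  rw [Fintype.bijective_iff_injective_and_card]
  constructor
  · rintro ⟨j, τ⟩ ⟨j', τ'⟩ h
    simp only at h
    have h1 : j = j' := by rw [← extPerm_self i j τ, h, extPerm_self]
    subst h1
    have : τ = τ' := by
      ext t
      have := extPerm_succAbove i j τ t
      rw [h, extPerm_succAbove] at this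
      rw [Fin.succAbove_right_injective this]
    rw [this]
  · simp [Fintype.card_perm, Nat.factorial_succ]

theorem val_succAbove {n : ℕ} (i : Fin (n + 1)) (t : Fin n) :
    (t.val < i.val ∧ (i.succAbove t).val = t.val) ∨
      (i.val ≤ t.val ∧ (i.succAbove t).val = t.val + 1) := by
  rcases lt_or_ge t.val i.val with h | h
  · left
    exact ⟨h, by rw [Fin.succAbove_of_castSucc_lt _ _ (by simpa [Fin.lt_def] using h)]; simp⟩
  · right
    exact ⟨h, by rw [Fin.succAbove_of_le_castSucc _ _ (by simpa [Fin.le_def] using h)]; simp⟩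

theorem shuffle_ext_iff {n μ ν : ℕ} (hν : 1 ≤ ν) (i j : Fin (n + 1))
    (τ : Equiv.Perm (Fin n)) (hi : μ ≤ i.val) (hi' : i.val < μ + ν) :
    IsShuffle3 μ ν (extPerm i j τ) ↔ IsShuffle3 μ (ν - 1) τ ∧
      ∀ t : Fin n, μ ≤ t.val → t.val < μ + (ν - 1) →
        (t.val < i.val → (τ t).val < j.val) ∧ (i.val ≤ t.val → j.val ≤ (τ t).val) := by
  constructor
  · rintro ⟨h1, h2, h3⟩
    refine ⟨⟨?_, ?_, ?_⟩, ?_⟩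
    · intro a b hab hb
      have := h1 (i.succAbove a) (i.succAbove b) (by simpa using hab)
        (by have := val_succAbove i b; omega)
      simpa [extPerm_succAbove] using this
    · intro a b hab ha hb
      have := h2 (i.succAbove a) (i.succAbove b) (by simpa using hab)
        (by have := val_succAbove i a; omega) (by have := val_succAbove i b; omega)
      simpa [extPerm_succAbove] using this
    · intro a b hab ha
      have := h3 (i.succAbove a) (i.succAbove b) (by simpa using hab)
        (by have := val_succAbove i a; omega)
      simpa [extPerm_succAbove] using this
    · intro t ht ht'
      have e := val_succAbove i t
      have e' := val_succAbove j (τ t)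
      constructor
      · intro h
        have := h2 (i.succAbove t) i (by rw [Fin.lt_def]; omega) (by omega) (by omega)
        rw [extPerm_succAbove, extPerm_self, Fin.lt_def] at this
        omega
      · intro h
        have := h2 i (i.succAbove t) (by rw [Fin.lt_def]; omega) (by omega) (by omega)
        rw [extPerm_succAbove, extPerm_self, Fin.lt_def] at this
        omega
  · rintro ⟨⟨h1, h2, h3⟩, h4⟩
    refine ⟨?_, ?_, ?_⟩
    · intro a b hab hb
      rcases Fin.eq_self_or_eq_succAbove i a with rfl | ⟨a, rfl⟩
      · rw [Fin.lt_def] at hab; omega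
      rcases Fin.eq_self_or_eq_succAbove i b with rfl | ⟨b, rfl⟩
      · omega
      have := h1 a b (by simpa using hab) (by have := val_succAbove i b; omega)
      simpa [extPerm_succAbove] using this
    · intro a b hab ha hb
      rcases Fin.eq_self_or_eq_succAbove i a with rfl | ⟨a, rfl⟩
      · rcases Fin.eq_self_or_eq_succAbove a b with rfl | ⟨b, rfl⟩
        · exact absurd hab (lt_irrefl _)
        rw [Fin.lt_def] at hab
        have e := val_succAbove a b
        have e' := val_succAbove j (τ b)
        have := (h4 b (by omega) (by omega)).2 (by omega)
        rw [extPerm_succAbove, extPerm_self, Fin.lt_def]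
        omega
      rcases Fin.eq_self_or_eq_succAbove i b with rfl | ⟨b, rfl⟩
      · rw [Fin.lt_def] at hab
        have e := val_succAbove b a
        have e' := val_succAbove j (τ a)
        have := (h4 a (by omega) (by omega)).1 (by omega)
        rw [extPerm_succAbove, extPerm_self, Fin.lt_def]
        omega
      have := h2 a b (by simpa using hab) (by have := val_succAbove i a; omega)
        (by have := val_succAbove i b; omega)
      simpa [extPerm_succAbove] using this
    · intro a b hab ha
      rcases Fin.eq_self_or_eq_succAbove i a with rfl | ⟨a, rfl⟩
      · omega
      rcases Fin.eq_self_or_eq_succAbove i b with rfl | ⟨b, rfl⟩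
      · rw [Fin.lt_def] at hab; omega
      have := h3 a b (by simpa using hab) (by have := val_succAbove i a; omega)
      simpa [extPerm_succAbove] using this

theorem exists_pos {n μ ν : ℕ} (hν : 1 ≤ ν) (hμν : μ + ν ≤ n + 1) (j : Fin (n + 1))
    (τ : Equiv.Perm (Fin n)) (hτ : IsShuffle3 μ (ν - 1) τ) :
    ∃! i : Fin (n + 1), (μ ≤ i.val ∧ i.val < μ + ν) ∧ IsShuffle3 μ ν (extPerm i j τ) := by
  classical
  let P : ℕ → Prop := fun k => μ ≤ k ∧ ∀ h : k < n, k < μ + (ν - 1) → j.val ≤ (τ ⟨k, h⟩).val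
  have hP : P (μ + (ν - 1)) := ⟨by omega, fun _ h => absurd h (lt_irrefl _)⟩
  have hex : ∃ k, P k := ⟨_, hP⟩
  obtain ⟨k, hk, hmin⟩ : ∃ k, P k ∧ ∀ m < k, ¬ P m :=
    ⟨Nat.find hex, Nat.find_spec hex, fun m hm => Nat.find_min hex hm⟩
  have hkle : k ≤ μ + (ν - 1) := by
    by_contra hc
    exact hmin _ (not_le.mp hc) hP
  refine ⟨⟨k, by omega⟩, ⟨⟨hk.1, by simp only; omega⟩, ?_⟩, ?_⟩
  · rw [shuffle_ext_iff hν _ _ _ hk.1 (by simp only; omega)]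
    refine ⟨hτ, fun t ht ht' => ⟨fun h => ?_, fun h => ?_⟩⟩
    · by_contra hc
      exact hmin t.val h ⟨ht, fun _ _ => not_lt.mp hc⟩
    · simp only at h
      have h0 := hk.2 (by omega) (by omega)
      rcases h.lt_or_eq with h | h
      · have := hτ.2.1 ⟨k, by omega⟩ t h hk.1 ht'
        rw [Fin.lt_def] at this
        omega
      · subst h
        exact h0
  · rintro i ⟨⟨hi, hi'⟩, hs⟩
    rw [shuffle_ext_iff hν _ _ _ hi hi'] at hs
    ext
    simp only
    rcases lt_trichotomy i.val k with h | h | h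
    · exact absurd ⟨hi, fun h1 h2 => (hs.2 ⟨i.val, h1⟩ hi h2).2 le_rfl⟩ (hmin _ h)
    · exact h
    · have h1 := (hs.2 ⟨k, by omega⟩ hk.1 (by simp only; omega)).1 h
      have h2 := hk.2 (by omega) (by omega)
      omega

open Classical in
/-- Summation identity over 3-shuffles, removal from the second block
(Lemma 4.1, identity (4.2), with `r = n + 1`): positions are 0-based, so the
1-based position `μ + i` with sign `(−1)^{μ+i−1}` becomes a position `i` with
`μ ≤ i.val < μ + ν` and sign `(−1)^{i.val}`. -/
theorem shuffle3_sum_second_block {R : Type*} [CommRing R] (n μ ν : ℕ)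
    (hν : 1 ≤ ν) (hμν : μ + ν ≤ n + 1)
    (Φ : (Fin n → Fin (n + 1)) → R) (Ψ : Fin (n + 1) → R) :
    (∑ σ : Equiv.Perm (Fin (n + 1)),
      if IsShuffle3 μ ν σ then
        ∑ i : Fin (n + 1), if μ ≤ i.val ∧ i.val < μ + ν then
          (-1 : R) ^ i.val * ((Equiv.Perm.sign σ : ℤ) : R) *
            Φ (fun j => σ (i.succAbove j)) * Ψ (σ i)
        else 0
      else 0)
    = ∑ j : Fin (n + 1), (-1 : R) ^ j.val * Ψ j *
        ∑ τ : Equiv.Perm (Fin n),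
          if IsShuffle3 μ (ν - 1) τ then
            ((Equiv.Perm.sign τ : ℤ) : R) * Φ (fun t => j.succAbove (τ t))
          else 0 := by
  have key : ∀ (j : Fin (n + 1)) (τ : Equiv.Perm (Fin n)) (c : R),
      (∑ i : Fin (n + 1), if (μ ≤ i.val ∧ i.val < μ + ν) ∧ IsShuffle3 μ ν (extPerm i j τ)
        then c else 0) = if IsShuffle3 μ (ν - 1) τ then c else 0 := by
    intro j τ c
    split_ifs with hτ
    · obtain ⟨i, hi, hu⟩ := exists_pos hν hμν j τ hτ
      rw [Finset.sum_eq_single i]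
      · rw [if_pos hi]
      · intro b _ hb
        rw [if_neg (fun h => hb (hu b h))]
      · simp
    · apply Finset.sum_eq_zero
      intro i _
      rw [if_neg]
      rintro ⟨⟨h1, h2⟩, h3⟩
      exact hτ ((shuffle_ext_iff hν _ _ _ h1 h2).1 h3).1
  calc _ = ∑ i : Fin (n + 1), ∑ σ : Equiv.Perm (Fin (n + 1)),
        if (μ ≤ i.val ∧ i.val < μ + ν) ∧ IsShuffle3 μ ν σ then
          (-1 : R) ^ i.val * ((Equiv.Perm.sign σ : ℤ) : R) *
            Φ (fun j => σ (i.succAbove j)) * Ψ (σ i) else 0 := by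
        rw [Finset.sum_comm]
        refine Finset.sum_congr rfl fun σ _ => ?_
        by_cases h : IsShuffle3 μ ν σ <;> simp [h]
    _ = ∑ i : Fin (n + 1), ∑ p : Fin (n + 1) × Equiv.Perm (Fin n),
        if (μ ≤ i.val ∧ i.val < μ + ν) ∧ IsShuffle3 μ ν (extPerm i p.1 p.2) then
          (-1 : R) ^ p.1.val * Ψ p.1 * (((Equiv.Perm.sign p.2 : ℤ) : R) *
            Φ (fun t => p.1.succAbove (p.2 t))) else 0 := by
        refine Finset.sum_congr rfl fun i _ => ?_
        refine (Fintype.sum_bijective _ (extPerm_bijective i) _ _ ?_).symm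
        rintro ⟨j, τ⟩
        simp only [extPerm_self, extPerm_succAbove, sign_extPerm]
        refine if_congr Iff.rfl ?_ rfl
        have h2 : (-1 : R) ^ i.val * (-1 : R) ^ i.val = 1 := by
          rw [← mul_pow]; simp
        push_cast
        rw [pow_add]
        linear_combination (-(-1 : R) ^ j.val * Ψ j * (((Equiv.Perm.sign τ : ℤ) : R) *
            Φ (fun t => j.succAbove (τ t)))) * h2
    _ = _ := by
        rw [Finset.sum_comm, Fintype.sum_prod_type]
        refine Finset.sum_congr rfl fun j _ => ?_
        rw [Finset.mul_sum]
        refine Finset.sum_congr rfl fun τ _ => ?_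
        rw [key, mul_ite, mul_zero]
end

section
/- Suppose μ ≤ r − 1. Then ∑_{σ ∈ J_{μ}(1,…,r)} ∑_{i=1}^{r−μ} (−1)^{μ+i−1}·(−1)^{σ}·Φ(σ(1), …, σ(μ+i)̂, …, σ(r))·Ψ(σ(μ+i)) = ∑_{j=1}^{r} (−1)^{j−1}·Ψ(j)·∑_{τ ∈ J_{μ}(1,…,ĵ,…,r)} (−1)^{τ}·Φ(τ(1), …, τ(r−1)), where σ(μ+i)̂ means the (μ+i)-th entry is omitted from the tuple (σ(1),…,σ(r)). (This is the 2-shuffle identity of the paper's Remark 4.2 for removal from the second block, i.e., the ν = 0 case of the 3-shuffle identity for the last block.) -/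
open Finset

/-- `σ` is a 2-shuffle with block sizes `μ` and `r − μ`: it is strictly
increasing on the first `μ` positions and on the remaining positions. -/
def IsShuffle2 {r : ℕ} (μ : ℕ) (σ : Equiv.Perm (Fin r)) : Prop :=
  (∀ i j : Fin r, i < j → j.val < μ → σ i < σ j) ∧
  (∀ i j : Fin r, i < j → μ ≤ i.val → σ i < σ j)

/-- Insert the value `j` at position `i` into the permutation `τ`. -/
def insPerm {n : ℕ} (i j : Fin (n + 1)) (τ : Equiv.Perm (Fin n)) : Equiv.Perm (Fin (n + 1)) :=
  j.cycleRange⁻¹ * Equiv.Perm.decomposeFin.symm (0, τ) * i.cycleRange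

theorem insPerm_self {n : ℕ} (i j : Fin (n + 1)) (τ : Equiv.Perm (Fin n)) :
    insPerm i j τ i = j := by
  have h := Fin.cycleRange_symm_zero j
  simpa [insPerm, Fin.cycleRange_self, Equiv.Perm.inv_def] using h

theorem insPerm_succAbove {n : ℕ} (i j : Fin (n + 1)) (τ : Equiv.Perm (Fin n)) (k : Fin n) :
    insPerm i j τ (i.succAbove k) = j.succAbove (τ k) := by
  have h := Fin.cycleRange_symm_succ j (τ k)
  simpa [insPerm, Fin.cycleRange_succAbove, Equiv.Perm.inv_def,
    Equiv.Perm.decomposeFin_symm_apply_succ] using h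

theorem insPerm_sign {n : ℕ} (i j : Fin (n + 1)) (τ : Equiv.Perm (Fin n)) :
    Equiv.Perm.sign (insPerm i j τ) = (-1) ^ j.val * Equiv.Perm.sign τ * (-1) ^ i.val := by
  simp [insPerm, Equiv.Perm.decomposeFin.symm_sign, Fin.sign_cycleRange]

theorem insPerm_bijective {n : ℕ} (i : Fin (n + 1)) :
    Function.Bijective (fun p : Fin (n + 1) × Equiv.Perm (Fin n) => insPerm i p.1 p.2) := by
  rw [Fintype.bijective_iff_injective_and_card]
  constructor
  · rintro ⟨j, τ⟩ ⟨j', τ'⟩ h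
    dsimp only at h
    have hj : j = j' := by rw [← insPerm_self i j τ, h, insPerm_self]
    subst hj
    have : τ = τ' := by
      ext1 k
      apply Fin.succAbove_right_injective (p := j)
      rw [← insPerm_succAbove i j τ, h, insPerm_succAbove]
    rw [this]
  · exact Fintype.card_congr Equiv.Perm.decomposeFin.symm

theorem succAbove_val {n : ℕ} (i : Fin (n + 1)) (k : Fin n) :
    (k.val < i.val ∧ (i.succAbove k).val = k.val) ∨
      (i.val ≤ k.val ∧ (i.succAbove k).val = k.val + 1) := by
  rcases lt_or_ge k.castSucc i with h | h
  · left
    exact ⟨h, by rw [Fin.succAbove_of_castSucc_lt _ _ h]; rfl⟩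
  · right
    exact ⟨h, by rw [Fin.succAbove_of_le_castSucc _ _ h]; rfl⟩

theorem isShuffle2_insPerm {n μ : ℕ} (i j : Fin (n + 1)) (hi : μ ≤ i.val)
    (τ : Equiv.Perm (Fin n)) :
    IsShuffle2 μ (insPerm i j τ) ↔ IsShuffle2 μ τ ∧
      ∀ k : Fin n, μ ≤ k.val → (k.val < i.val ↔ (τ k).val < j.val) := by
  have mono : ∀ (p : Fin (n + 1)) (a b : Fin n), p.succAbove a < p.succAbove b ↔ a < b :=
    fun p a b => Fin.succAbove_lt_succAbove_iff
  constructor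
  · rintro ⟨h1, h2⟩
    refine ⟨⟨fun a b hab hb => ?_, fun a b hab ha => ?_⟩, fun k hk => ?_⟩
    · have := h1 (i.succAbove a) (i.succAbove b) ((mono _ _ _).2 hab)
        (by rcases succAbove_val i b with h | h <;> omega)
      rwa [insPerm_succAbove, insPerm_succAbove, mono] at this
    · have := h2 (i.succAbove a) (i.succAbove b) ((mono _ _ _).2 hab)
        (by rcases succAbove_val i a with h | h <;> omega)
      rwa [insPerm_succAbove, insPerm_succAbove, mono] at this
    · rcases succAbove_val i k with h | h
      · have := h2 (i.succAbove k) i (by rw [Fin.lt_def]; omega) (by omega)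
        rw [insPerm_succAbove, insPerm_self, Fin.lt_def] at this
        rcases succAbove_val j (τ k) with h' | h' <;> omega
      · have := h2 i (i.succAbove k) (by rw [Fin.lt_def]; omega) (by omega)
        rw [insPerm_succAbove, insPerm_self, Fin.lt_def] at this
        rcases succAbove_val j (τ k) with h' | h' <;> omega
  · rintro ⟨⟨h1, h2⟩, h3⟩
    refine ⟨fun a b hab hb => ?_, fun a b hab ha => ?_⟩
    · rcases Fin.eq_self_or_eq_succAbove i a with rfl | ⟨a, rfl⟩
      · rw [Fin.lt_def] at hab; omega
      rcases Fin.eq_self_or_eq_succAbove i b with rfl | ⟨b, rfl⟩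
      · omega
      rw [insPerm_succAbove, insPerm_succAbove, mono]
      rw [mono] at hab
      exact h1 a b hab (by rcases succAbove_val i b with h | h <;> omega)
    · rcases Fin.eq_self_or_eq_succAbove i a with rfl | ⟨a, rfl⟩
      · rcases Fin.eq_self_or_eq_succAbove a b with rfl | ⟨b, rfl⟩
        · exact absurd hab (lt_irrefl _)
        rw [insPerm_succAbove, insPerm_self, Fin.lt_def]
        rw [Fin.lt_def] at hab
        have := h3 b
        rcases succAbove_val a b with h | h <;>
        rcases succAbove_val j (τ b) with h' | h' <;> omega
      · have ha' : μ ≤ a.val := by rcases succAbove_val i a with h | h <;> omega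
        rcases Fin.eq_self_or_eq_succAbove i b with rfl | ⟨b, rfl⟩
        · rw [insPerm_succAbove, insPerm_self, Fin.lt_def]
          rw [Fin.lt_def] at hab
          have := h3 a ha'
          rcases succAbove_val b a with h | h <;>
          rcases succAbove_val j (τ a) with h' | h' <;> omega
        · rw [insPerm_succAbove, insPerm_succAbove, mono]
          rw [mono] at hab
          exact h2 a b hab ha'

theorem exists_insert_pos {n μ : ℕ} (hμ : μ ≤ n) (j : Fin (n + 1)) (τ : Equiv.Perm (Fin n))
    (hτ : IsShuffle2 μ τ) :
    ∃ i : Fin (n + 1), μ ≤ i.val ∧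
      ∀ k : Fin n, μ ≤ k.val → (k.val < i.val ↔ (τ k).val < j.val) := by
  classical
  have hex : ∃ m, μ ≤ m ∧ ∀ k : Fin n, m ≤ k.val → ¬ (τ k).val < j.val :=
    ⟨n, hμ, fun k hk => by omega⟩
  have hle : Nat.find hex ≤ n := Nat.find_min' hex ⟨hμ, fun k hk => by omega⟩
  obtain ⟨hm1, hm2⟩ := Nat.find_spec hex
  refine ⟨⟨Nat.find hex, by omega⟩, hm1, fun k hk => ⟨fun hlt => ?_, fun h => ?_⟩⟩
  · have hlt : k.val < Nat.find hex := hlt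
    have := Nat.find_min hex hlt
    push Not at this
    obtain ⟨k', hk', h'⟩ := this hk
    rcases eq_or_lt_of_le hk' with he | hl
    · rwa [Fin.ext he]
    · have := hτ.2 k k' hl hk
      rw [Fin.lt_def] at this
      omega
  · by_contra hc
    exact hm2 k (by simpa using hc) h

open Classical in
/-- Summation identity over 2-shuffles, removal from the second block
(Remark 4.2, identity (4.5), with `r = n + 1`; the hypothesis `μ ≤ n` says
`μ ≤ r − 1`): positions are 0-based, so the 1-based position `μ + i` with sign
`(−1)^{μ+i−1}` becomes a position `i` with `μ ≤ i.val` and sign `(−1)^{i.val}`. -/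
theorem shuffle2_sum_second_block {R : Type*} [CommRing R] (n μ : ℕ)
    (hμ : μ ≤ n)
    (Φ : (Fin n → Fin (n + 1)) → R) (Ψ : Fin (n + 1) → R) :
    (∑ σ : Equiv.Perm (Fin (n + 1)),
      if IsShuffle2 μ σ then
        ∑ i : Fin (n + 1), if μ ≤ i.val then
          (-1 : R) ^ i.val * ((Equiv.Perm.sign σ : ℤ) : R) *
            Φ (fun j => σ (i.succAbove j)) * Ψ (σ i)
        else 0
      else 0)
    = ∑ j : Fin (n + 1), (-1 : R) ^ j.val * Ψ j *
        ∑ τ : Equiv.Perm (Fin n),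
          if IsShuffle2 μ τ then
            ((Equiv.Perm.sign τ : ℤ) : R) * Φ (fun t => j.succAbove (τ t))
          else 0 := by
  have key : ∀ i : Fin (n + 1), (∑ σ : Equiv.Perm (Fin (n + 1)),
      if IsShuffle2 μ σ then
        if μ ≤ i.val then
          (-1 : R) ^ i.val * ((Equiv.Perm.sign σ : ℤ) : R) *
            Φ (fun j => σ (i.succAbove j)) * Ψ (σ i)
        else 0
      else 0) = ∑ j : Fin (n + 1), ∑ τ : Equiv.Perm (Fin n),
        if μ ≤ i.val ∧ IsShuffle2 μ (insPerm i j τ) then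
          (-1 : R) ^ j.val * Ψ j *
            (((Equiv.Perm.sign τ : ℤ) : R) * Φ (fun t => j.succAbove (τ t)))
        else 0 := by
    intro i
    rw [← Fintype.sum_prod_type', ← (insPerm_bijective i).sum_comp]
    refine Finset.sum_congr rfl fun p _ => ?_
    obtain ⟨j, τ⟩ := p
    simp only [insPerm_self, insPerm_succAbove, insPerm_sign]
    by_cases h1 : μ ≤ i.val <;> by_cases h2 : IsShuffle2 μ (insPerm i j τ) <;>
      simp only [h1, h2, if_true, if_false, and_self, and_true, and_false, false_and]
    have e : (-1 : R) ^ i.val * (-1 : R) ^ i.val = 1 := by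
      rw [← mul_pow]; simp
    push_cast
    linear_combination ((-1 : R) ^ j.val * Ψ j *
            (((Equiv.Perm.sign τ : ℤ) : R) * Φ (fun t => j.succAbove (τ t)))) * e
  have lhs : ∀ σ : Equiv.Perm (Fin (n + 1)), (if IsShuffle2 μ σ then
        ∑ i : Fin (n + 1), if μ ≤ i.val then
          (-1 : R) ^ i.val * ((Equiv.Perm.sign σ : ℤ) : R) *
            Φ (fun j => σ (i.succAbove j)) * Ψ (σ i)
        else 0
      else 0) = ∑ i : Fin (n + 1), if IsShuffle2 μ σ then
        if μ ≤ i.val then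
          (-1 : R) ^ i.val * ((Equiv.Perm.sign σ : ℤ) : R) *
            Φ (fun j => σ (i.succAbove j)) * Ψ (σ i)
        else 0
      else 0 := by
    intro σ
    split_ifs <;> simp
  rw [Finset.sum_congr rfl fun σ _ => lhs σ, Finset.sum_comm,
    Finset.sum_congr rfl fun i _ => key i, Finset.sum_comm]
  refine Finset.sum_congr rfl fun j _ => ?_
  rw [Finset.sum_comm, Finset.mul_sum]
  refine Finset.sum_congr rfl fun τ _ => ?_
  by_cases hτ : IsShuffle2 μ τ
  · obtain ⟨i, hi, hk⟩ := exists_insert_pos hμ j τ hτ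
    rw [Finset.sum_eq_single i]
    · rw [if_pos ⟨hi, (isShuffle2_insPerm i j hi τ).2 ⟨hτ, hk⟩⟩, if_pos hτ]
    · intro i' _ hne
      rw [if_neg]
      rintro ⟨hi', hs⟩
      have hk' := ((isShuffle2_insPerm i' j hi' τ).1 hs).2
      rcases lt_or_gt_of_ne hne with h | h
      · rw [Fin.lt_def] at h
        have a := hk ⟨i'.val, by omega⟩ hi'
        have b := hk' ⟨i'.val, by omega⟩ hi'
        exact absurd (b.2 (a.1 h)) (lt_irrefl _)
      · rw [Fin.lt_def] at h
        have a := hk ⟨i.val, by omega⟩ hi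
        have b := hk' ⟨i.val, by omega⟩ hi
        exact absurd (a.2 (b.1 h)) (lt_irrefl _)
    · intro h
      exact absurd (Finset.mem_univ _) h
  · rw [if_neg hτ, mul_zero]
    refine Finset.sum_eq_zero fun i _ => ?_
    rw [if_neg]
    rintro ⟨hi, hs⟩
    exact hτ ((isShuffle2_insPerm i j hi τ).1 hs).1
end
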